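/- Let S be a reflective numerical semigroup with genus g(S) = g ≥ 1 and multiplicity m(S) = a, and let r be the unique integer in {1, ..., a−1} with g ≡ r (mod a). Then the Apéry set of S relative to a is Ap(S; a) = {0, 2g + a − r} ∪ ({g+1, ..., g+(a−1)} \ {g+(a−r)}). -/

import Mathlib

/-- A numerical semigroup: a subset of ℕ containing 0, closed under addition,
with finite complement. -/
def IsNumericalSemigroup (S : Set ℕ) : Prop :=
  0 ∈ S ∧ (∀ a ∈ S, ∀ b ∈ S, a + b ∈ S) ∧ Sᶜ.Finite

/-- The genus: number of gaps. -/
noncomputable def genus (S : Set ℕ) : ℕ := Sᶜ.ncard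

/-- The Frobenius number: the largest gap. -/
noncomputable def frob (S : Set ℕ) : ℕ := sSup Sᶜ

/-- The multiplicity: the smallest positive element. -/
noncomputable def mult (S : Set ℕ) : ℕ := sInf {n ∈ S | 0 < n}

/-- A numerical semigroup is reflective if for each z ∈ {0,...,g-1}
exactly one of z and z + g lies in S, where g is the genus. -/
def Reflective (S : Set ℕ) : Prop :=
  ∀ z < genus S, Xor' (z ∈ S) (z + genus S ∈ S)

/-- A set A is equidistributed modulo m if each residue class mod m contains
the same number of elements of A. -/
def Equidistributed (A : Set ℕ) (m : ℕ) : Prop :=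
  ∀ r₁ < m, ∀ r₂ < m, {x ∈ A | x % m = r₁}.ncard = {x ∈ A | x % m = r₂}.ncard

/-- The submonoid of ℕ generated by A. -/
def gen (A : Set ℕ) : Set ℕ := (AddSubmonoid.closure A : Set ℕ)

/-- The (unique) minimal generating set of a numerical semigroup: nonzero elements
not expressible as a sum of two nonzero elements. -/
def minGens (S : Set ℕ) : Set ℕ :=
  {n ∈ S | n ≠ 0 ∧ ∀ a ∈ S, ∀ b ∈ S, a ≠ 0 → b ≠ 0 → n ≠ a + b}

/-- The embedding dimension: the cardinality of the minimal generating set. -/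
noncomputable def embdim (S : Set ℕ) : ℕ := (minGens S).ncard

/-- The Apéry set of S relative to t: elements s of S with s - t ∉ S. -/
def aperySet (S : Set ℕ) (t : ℕ) : Set ℕ := {s ∈ S | ∀ u ∈ S, s ≠ u + t}

/-- Pseudo-Frobenius numbers: gaps h such that h + s ∈ S for every nonzero s ∈ S. -/
def pseudoFrobenius (S : Set ℕ) : Set ℕ :=
  {h | h ∉ S ∧ ∀ s ∈ S, s ≠ 0 → h + s ∈ S}

/-- Membership of an integer in (the image in ℤ of) a numerical semigroup. -/
def memZ (S : Set ℕ) (z : ℤ) : Prop := 0 ≤ z ∧ z.toNat ∈ S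

/-- Symmetric numerical semigroup. -/
def IsSymmetricNS (S : Set ℕ) : Prop :=
  ∀ z : ℤ, Xor' (memZ S z) (memZ S ((frob S : ℤ) - z))

/-- Pseudo-symmetric numerical semigroup. -/
def IsPseudoSymmetricNS (S : Set ℕ) : Prop :=
  2 ∣ frob S ∧ ∀ z : ℤ, z ≠ (frob S : ℤ) / 2 →
    Xor' (memZ S z) (memZ S ((frob S : ℤ) - z))

/-- Irreducible numerical semigroup. -/
def IsIrreducibleNS (S : Set ℕ) : Prop :=
  ¬ ∃ T₁ T₂ : Set ℕ, IsNumericalSemigroup T₁ ∧ IsNumericalSemigroup T₂ ∧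
    S ⊂ T₁ ∧ S ⊂ T₂ ∧ S = T₁ ∩ T₂

/-- A telescopic sequence a₁,...,a_k (1-indexed) of positive integers. -/
def TelescopicSeq (a : ℕ → ℕ) (k : ℕ) : Prop :=
  (∀ i ∈ Finset.Icc 1 k, 0 < a i) ∧
  ∀ j ∈ Finset.Icc 2 k,
    ((Finset.Icc 1 (j-1)).gcd a / (Finset.Icc 1 j).gcd a) * a j ∈
      gen (a '' Set.Icc 1 (j-1))

/-- A free numerical semigroup: one generated by (the underlying set of)
a telescopic sequence. -/
def IsFreeNS (S : Set ℕ) : Prop :=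
  ∃ (k : ℕ) (a : ℕ → ℕ), TelescopicSeq a k ∧ S = gen (a '' Set.Icc 1 k)

/-- The gaps of a reflective numerical semigroup are smaller than twice the genus. -/
theorem Reflective.mem_of_two_mul_genus_le {S : Set ℕ} (hS : IsNumericalSemigroup S)
    (hrefl : Reflective S) {n : ℕ} (hn : 2 * genus S ≤ n) : n ∈ S := by
  classical
  by_contra hnS
  have hcard : hS.2.2.toFinset.card = genus S := (Set.ncard_eq_toFinset_card _ hS.2.2).symm
  have hmem : n ∈ hS.2.2.toFinset := by simpa using hnS
  have hle : (Finset.range (genus S)).card ≤ (hS.2.2.toFinset.erase n).card := by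
    refine Finset.card_le_card_of_injOn (fun z => if z ∈ S then z + genus S else z) ?_ ?_
    · intro z hz
      have hz : z < genus S := by simpa using hz
      have := hrefl z hz
      simp only [Finset.coe_erase, Set.Finite.coe_toFinset, Set.mem_sdiff, Set.mem_compl_iff,
        Set.mem_singleton_iff]
      rcases this with ⟨h1, h2⟩ | ⟨h1, h2⟩
      · rw [if_pos h1]
        exact ⟨h2, by omega⟩
      · rw [if_neg h2]
        exact ⟨h2, by omega⟩
    · intro x hx y hy hxy
      have hx : x < genus S := by simpa using hx
      have hy : y < genus S := by simpa using hy
      dsimp only at hxy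
      split_ifs at hxy <;> omega
  rw [Finset.card_erase_of_mem hmem, Finset.card_range, hcard] at hle
  have := Finset.card_pos.2 ⟨n, hmem⟩
  omega

theorem mult_le_of_mem {S : Set ℕ} {n : ℕ} (hn : n ∈ S) (hpos : 0 < n) : mult S ≤ n :=
  Nat.sInf_le ⟨hn, hpos⟩

theorem IsNumericalSemigroup.mult_mem {S : Set ℕ} (hS : IsNumericalSemigroup S) :
    mult S ∈ S := by
  obtain ⟨b, hb⟩ := hS.2.2.bddAbove
  have hne : {n ∈ S | 0 < n}.Nonempty := by
    refine ⟨b + 1, ?_, b.succ_pos⟩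
    by_contra h
    have := hb h
    omega
  exact (Nat.sInf_mem hne).1

theorem IsNumericalSemigroup.mul_mem {S : Set ℕ} (hS : IsNumericalSemigroup S) {n : ℕ}
    (hn : n ∈ S) (k : ℕ) : n * k ∈ S := by
  induction k with
  | zero => simpa using hS.1
  | succ k ih => rw [Nat.mul_succ]; exact hS.2.1 _ ih _ hn

/-- Below the genus, a reflective numerical semigroup consists of the multiples of its
multiplicity. -/
theorem Reflective.mem_iff_mult_dvd {S : Set ℕ} (hS : IsNumericalSemigroup S)
    (hrefl : Reflective S) {w : ℕ} (hw : w < genus S) : w ∈ S ↔ mult S ∣ w := by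
  constructor
  · induction w using Nat.strong_induction_on with
    | _ w ih =>
      intro hwS
      rcases Nat.eq_zero_or_pos w with rfl | hpos
      · exact dvd_zero _
      have hle := mult_le_of_mem hwS hpos
      have hmpos : 0 < mult S :=
        (Nat.sInf_mem (s := {n ∈ S | 0 < n}) ⟨w, hwS, hpos⟩).2
      have hsub : w - mult S ∈ S := by
        by_contra hcon
        have h1 : w - mult S + genus S ∈ S := by
          rcases hrefl (w - mult S) (by omega) with h | h
          · exact absurd h.1 hcon
          · exact h.1
        have h2 := hS.2.1 _ h1 _ hS.mult_mem
        rw [show w - mult S + genus S + mult S = w + genus S by omega] at h2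
        rcases hrefl w hw with h | h
        · exact h.2 h2
        · exact h.2 hwS
      have := Nat.dvd_add (ih _ (by omega) (by omega) hsub) dvd_rfl
      rwa [Nat.sub_add_cancel hle] at this
  · rintro ⟨k, rfl⟩
    exact hS.mul_mem hS.mult_mem k

theorem stmt8 (S : Set ℕ) (hS : IsNumericalSemigroup S) (hrefl : Reflective S)
    (g a r : ℕ) (hg : genus S = g) (hg1 : 1 ≤ g) (ha : mult S = a)
    (hr1 : 1 ≤ r) (hr2 : r ≤ a - 1) (hmod : g % a = r) :
    aperySet S a =
      {0, 2 * g + a - r} ∪ (Set.Icc (g + 1) (g + (a - 1)) \ {g + (a - r)}) := by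
  subst hg ha
  have hbig : ∀ n, 2 * genus S ≤ n → n ∈ S := fun n => hrefl.mem_of_two_mul_genus_le hS
  have hdvd : ∀ w < genus S, (w ∈ S ↔ mult S ∣ w) := fun w => hrefl.mem_iff_mult_dvd hS
  have hmin : ∀ n ∈ S, 0 < n → mult S ≤ n := fun n => mult_le_of_mem
  have haS := hS.mult_mem
  have hadd := hS.2.1
  have h0 := hS.1
  have hx : ∀ z < genus S, (z ∈ S ↔ z + genus S ∉ S) := fun z hz => by
    rcases hrefl z hz with ⟨h1, h2⟩ | ⟨h1, h2⟩ <;> simp [h1, h2]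
  generalize genus S = g at *
  generalize mult S = a at *
  clear hrefl hS
  have hrg : r ≤ g := hmod ▸ Nat.mod_le g a
  have hgr : a ∣ g - r := hmod ▸ Nat.dvd_sub_mod g
  have hgS : g ∉ S := by simpa using (hx 0 hg1).1 h0
  have hgrS : g - r ∈ S := (hdvd _ (by omega)).2 hgr
  have huniq : ∀ z, a ∣ z → z < g → g ≤ z + a → z = g - r := by
    rintro z ⟨k, rfl⟩ h1 h2
    obtain ⟨q, hq⟩ := hgr
    have hk : k < q + 1 := by
      apply Nat.lt_of_mul_lt_mul_left (a := a)
      rw [Nat.mul_succ]; omega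
    have hq' : q < k + 1 := by
      apply Nat.lt_of_mul_lt_mul_left (a := a)
      rw [Nat.mul_succ]; omega
    rw [hq, show k = q by omega]
  ext s
  simp only [aperySet, Set.mem_ofPred_eq, Set.mem_union, Set.mem_insert_iff,
    Set.mem_singleton_iff, Set.mem_sdiff, Set.mem_Icc]
  constructor
  · rintro ⟨hsS, hs⟩
    rcases Nat.eq_zero_or_pos s with rfl | hpos
    · simp
    have hle := hmin s hsS hpos
    obtain ⟨u, rfl⟩ := Nat.exists_eq_add_of_le' hle
    have hu : u ∉ S := fun h => hs u h rfl
    have hu2 : u < 2 * g := by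
      by_contra h
      exact hu (hbig u (by omega))
    rcases lt_or_ge u g with hug | hug
    · right
      refine ⟨⟨?_, by omega⟩, ?_⟩
      · by_contra h
        have hne : u + a ≠ g := fun h' => hgS (h' ▸ hsS)
        have := (hdvd _ (by omega)).1 hsS
        exact hu ((hdvd u hug).2 ((Nat.dvd_add_left dvd_rfl).1 this))
      · intro h
        exact hu ((show u = g - r by omega) ▸ hgrS)
    · obtain ⟨z, rfl⟩ := Nat.exists_eq_add_of_le' hug
      have hzS : z ∈ S := (hx z (by omega)).2 hu
      have hza : a ∣ z := (hdvd z (by omega)).1 hzS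
      have hzg : g ≤ z + a := by
        by_contra h
        apply (hx (z + a) (by omega)).1 (hadd _ hzS _ haS)
        rwa [show z + a + g = z + g + a by omega]
      have := huniq z hza (by omega) hzg
      left; right; omega
  · rintro ((rfl | rfl) | ⟨⟨h1, h2⟩, h3⟩)
    · exact ⟨h0, fun u _ => by omega⟩
    · refine ⟨hbig _ (by omega), fun u hu h => (hx (g - r) (by omega)).1 hgrS ?_⟩
      rwa [show g - r + g = u by omega]
    · constructor
      · rcases lt_or_ge s (2 * g) with hs | hs
        · obtain ⟨i, rfl⟩ := Nat.exists_eq_add_of_le' (show g ≤ s by omega)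
          by_contra h
          have := hmin i ((hx i (by omega)).2 h) (by omega)
          omega
        · exact hbig s hs
      · rintro u hu rfl
        have := huniq u ((hdvd u (by omega)).1 hu) (by omega) (by omega)
        omega
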